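/- Let X be a standard Borel space and let E be an aperiodic, countable Borel equivalence relation on X. If the weak Borel Ramsey property E →*_B (E)^n_k holds for some integers n, k > 1, then E is smooth. -/

import Mathlib

open Classical

noncomputable section

/-- `Y` is a complete section for `E`: it meets every `E`-class. -/
def IsCompleteSection {X : Type*} (E : X → X → Prop) (Y : Set X) : Prop :=
  ∀ x : X, ∃ y ∈ Y, E x y

/-- `Y` is an infinite complete section for `E`: it meets every `E`-class in an infinite set. -/
def IsInfiniteCompleteSection {X : Type*} (E : X → X → Prop) (Y : Set X) : Prop :=
  ∀ x : X, {y | y ∈ Y ∧ E x y}.Infinite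

/-- A coloring `c` of the `n`-element subsets of single `E`-classes (encoded as a function on
finsets) is `E`-monochromatic on `Y`: for every `x` there is a color `a` such that every
`n`-element subset of `Y` contained in `[x]_E` gets color `a`. -/
def IsMonochromatic {X : Type*} (E : X → X → Prop) (n : ℕ) {k : ℕ}
    (c : Finset X → Fin k) (Y : Set X) : Prop :=
  ∀ x : X, ∃ a : Fin k, ∀ A : Finset X, A.card = n → ↑A ⊆ Y → (∀ y ∈ A, E x y) → c A = a

/-- `c` is a Borel coloring of dimension `n`: the induced map on `n`-tuples is measurable. -/
def IsBorelColoring {X : Type*} [MeasurableSpace X] (n : ℕ) {k : ℕ}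
    (c : Finset X → Fin k) : Prop :=
  Measurable fun v : Fin n → X => c (Set.finite_range v).toFinset

/-- The strong Borel Ramsey property `E →_B (E)^n_k`: every Borel `E`-coloring of dimension
`n` by `k` colors admits a Borel `E`-monochromatic infinite complete section. -/
def StrongBorelRamsey {X : Type*} [MeasurableSpace X] (E : X → X → Prop) (n k : ℕ) : Prop :=
  ∀ c : Finset X → Fin k, IsBorelColoring n c →
    ∃ Y : Set X, MeasurableSet Y ∧ IsInfiniteCompleteSection E Y ∧ IsMonochromatic E n c Y

/-- The weak Borel Ramsey property `E →*_B (E)^n_k`: every Borel `E`-coloring of dimension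
`n` by `k` colors admits a Borel `E`-monochromatic complete section. -/
def WeakBorelRamsey {X : Type*} [MeasurableSpace X] (E : X → X → Prop) (n k : ℕ) : Prop :=
  ∀ c : Finset X → Fin k, IsBorelColoring n c →
    ∃ Y : Set X, MeasurableSet Y ∧ IsCompleteSection E Y ∧ IsMonochromatic E n c Y

/-- `E` is smooth: Borel reducible to equality on a standard Borel space. -/
def IsSmooth {X : Type*} [MeasurableSpace X] (E : X → X → Prop) : Prop :=
  ∃ (Z : Type) (mZ : MeasurableSpace Z), @StandardBorelSpace Z mZ ∧
    ∃ f : X → Z, @Measurable X Z _ mZ f ∧ ∀ x y : X, E x y ↔ f x = f y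

/-- The eventual agreement relation `E₀` on Cantor space `2^ℕ`. -/
def E0 (x y : ℕ → Bool) : Prop := ∃ n : ℕ, ∀ m ≥ n, x m = y m

/-- `Σ_{i<δ(x,y)} x i + Σ_{i<δ(x,y)} y i`, where `δ(x,y)` is the least `n` with
`x m = y m` for all `m ≥ n`; junk value `0` if `x` and `y` are not `E₀`-related. -/
def colorSum (x y : ℕ → Bool) : ℕ :=
  if h : ∃ n : ℕ, ∀ m ≥ n, x m = y m then
    ((Finset.range (Nat.find h)).sum fun i => (x i).toNat) +
    ((Finset.range (Nat.find h)).sum fun i => (y i).toNat)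
  else 0

/-- The coloring `c` of the paper: a pair `{x,y}` of distinct `E₀`-related points gets color
`0` (representing color `1`) if `colorSum x y` is even, and color `1` (representing color `2`)
otherwise. -/
def c0 : Finset (ℕ → Bool) → Fin 2 := fun A =>
  if ∃ x y : ℕ → Bool, x ≠ y ∧ A = {x, y} ∧ E0 x y ∧ Even (colorSum x y) then 0 else 1

/-- The subrelation `F` of `E₀`: `x F y` iff `x = y` or `c ({x,y}) = 1` (even `colorSum`). -/
def F0 (x y : ℕ → Bool) : Prop := x = y ∨ (E0 x y ∧ Even (colorSum x y))

/-- The map flipping coordinate `0`. -/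
def flip0 (x : ℕ → Bool) : ℕ → Bool := fun n => if n = 0 then !(x 0) else x n

/-- Eventual agreement of `X`-valued sequences: the relation `E₀(X)` on `X^ℕ`
(denoted `E₁` when `X` is uncountable). -/
def E1rel {X : Type*} (u v : ℕ → X) : Prop := ∃ N : ℕ, ∀ j ≥ N, u j = v j

/-- `S` is a monochromatic reduction to `E₁` for the coloring `c` of dimension `n`:
each `S x` is injective, its range is a monochromatic subset of `[x]_E`, and
`x E y ↔ S x E₁ S y`. -/
def IsMonochromaticReduction {X : Type*} (E : X → X → Prop) (n : ℕ) {k : ℕ}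
    (c : Finset X → Fin k) (S : X → ℕ → X) : Prop :=
  (∀ x : X, Function.Injective (S x)) ∧
  (∀ x : X, (∀ i : ℕ, E x (S x i)) ∧
    ∃ a : Fin k, ∀ A : Finset X, A.card = n → ↑A ⊆ Set.range (S x) → c A = a) ∧
  (∀ x y : X, E x y ↔ E1rel (S x) (S y))

/-- `c` is an almost transitive coloring of dimension `n` for `E`: for every `m ≥ n`, every
`A ∈ [X]^m_E` and all `(n-1)`-element subsets `B₁, B₂ ⊆ A`, one has
`c ({z} ∪ B₁) = c ({z} ∪ B₂)` for all but finitely many `z` in the `E`-saturation of `A`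
outside `B₁ ∪ B₂`. -/
def AlmostTransitive {X : Type*} (E : X → X → Prop) (n : ℕ) {k : ℕ}
    (c : Finset X → Fin k) : Prop :=
  ∀ m : ℕ, n ≤ m → ∀ A : Finset X, A.card = m → (∀ x ∈ A, ∀ y ∈ A, E x y) →
    ∀ B₁ B₂ : Finset X, B₁ ⊆ A → B₂ ⊆ A → B₁.card = n - 1 → B₂.card = n - 1 →
      {z : X | (∃ a ∈ A, E a z) ∧ z ∉ B₁ ∪ B₂ ∧ c (insert z B₁) ≠ c (insert z B₂)}.Finite

open MeasureTheory Topology Filter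

/-- An analytic set on which a continuous map is injective is contained in a Borel such set. -/
lemma BR.analytic_injOn {P X : Type*} [TopologicalSpace P] [PolishSpace P] [MeasurableSpace P]
    [BorelSpace P] [TopologicalSpace X] [PolishSpace X] [MeasurableSpace X] [BorelSpace X]
    (π : P → X) (hπ : Continuous π) (A : Set P) (hA : AnalyticSet A) (hinj : Set.InjOn π A) :
    ∃ B : Set P, MeasurableSet B ∧ A ⊆ B ∧ Set.InjOn π B := by
  have hb := TopologicalSpace.isBasis_countableBasis P
  have hsep : ∀ b : TopologicalSpace.countableBasis P,
      MeasurablySeparable (π '' (A ∩ b)) (π '' (A ∩ (b : Set P)ᶜ)) := by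
    intro b
    have hbo : IsOpen (b : Set P) := hb.isOpen b.2
    have inter : ∀ S T : Set P, AnalyticSet S → AnalyticSet T → AnalyticSet (S ∩ T) := by
      intro S T hS hT
      rw [Set.inter_eq_iInter]
      exact AnalyticSet.iInter (fun i => by cases i <;> assumption)
    apply AnalyticSet.measurablySeparable
    · exact (inter _ _ hA hbo.measurableSet.analyticSet).image_of_continuous hπ
    · exact (inter _ _ hA hbo.measurableSet.compl.analyticSet).image_of_continuous hπ
    · rw [Set.disjoint_left]
      rintro _ ⟨p, hp, rfl⟩ ⟨q, hq, hqp⟩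
      have := hinj hq.1 hp.1 hqp
      subst this
      exact hq.2 hp.2
  choose D hD1 hD2 hD3 using hsep
  refine ⟨⋂ b : TopologicalSpace.countableBasis P, {p | p ∈ (b : Set P) ↔ π p ∈ D b}, ?_, ?_, ?_⟩
  · have : Countable (TopologicalSpace.countableBasis P) :=
      (TopologicalSpace.countable_countableBasis P).to_subtype
    refine MeasurableSet.iInter fun b => ?_
    have hbo : IsOpen (b : Set P) := hb.isOpen b.2
    exact (hbo.measurableSet.mem).iff ((hπ.measurable (hD3 b)).mem) |>.setOf
  · intro p hp
    simp only [Set.mem_iInter]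
    intro b
    constructor
    · intro h
      exact hD1 b ⟨p, ⟨hp, h⟩, rfl⟩
    · intro h
      by_contra hn
      exact Set.disjoint_left.1 (hD2 b) ⟨p, ⟨hp, hn⟩, rfl⟩ h
  · intro p hp q hq hpq
    simp only [Set.mem_iInter] at hp hq
    by_contra hne
    obtain ⟨b, hb1, hb2, hb3⟩ := hb.exists_subset_of_mem_open (show p ∈ ({q}ᶜ : Set P) from hne)
      isOpen_compl_singleton
    have h1 := (hp ⟨b, hb1⟩).1 hb2
    rw [hpq] at h1
    exact hb3 ((hq ⟨b, hb1⟩).2 h1) rfl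

/-- Core of Lusin-Novikov: either `P` is covered by countably many Borel sets on which `π` is
injective, or there is a set `B` in which configurations may be split. -/
lemma BR.splitting {P X : Type*} [TopologicalSpace P] [PolishSpace P] [MeasurableSpace P]
    [BorelSpace P] [TopologicalSpace X] [PolishSpace X] [MeasurableSpace X] [BorelSpace X]
    (π : P → X) (hπ : Continuous π)
    (hno : ¬ ∃ T : Set (Set P), T.Countable ∧ (∀ t ∈ T, MeasurableSet t ∧ Set.InjOn π t) ∧
      ⋃₀ T = Set.univ) :
    ∃ B : Set P, B.Nonempty ∧ ∀ (m : ℕ) (c : Fin m → P) (V : Fin m → Set P) (j : Fin m),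
      (∀ i, c i ∈ B) → (∀ i, IsOpen (V i)) → (∀ i, c i ∈ V i) → (∀ i i', π (c i) = π (c i')) →
      ∃ (c' : Fin m → P) (q : P), (∀ i, c' i ∈ B ∧ c' i ∈ V i) ∧ (∀ i, π (c' i) = π q) ∧
        q ∈ B ∧ q ∈ V j ∧ q ≠ c' j := by
  have hb := TopologicalSpace.isBasis_countableBasis P
  have : Countable (TopologicalSpace.countableBasis P) :=
      (TopologicalSpace.countable_countableBasis P).to_subtype
  let K := Σ m : ℕ, (Fin m → TopologicalSpace.countableBasis P) × Fin m
  let A : K → Set P → Set P := fun k B => (fun c : Fin k.1 → P => c k.2.2) ''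
    {c | (∀ i, c i ∈ ((k.2.1 i : Set P) ∩ B)) ∧ ∀ i i', π (c i) = π (c i')}
  have hAan : ∀ k B, MeasurableSet B → AnalyticSet (A k B) := by
    intro k B hB
    apply MeasurableSet.analyticSet_image
    · have hU : ∀ i, MeasurableSet ((k.2.1 i : Set P) ∩ B) := fun i =>
        (hb.isOpen (k.2.1 i).2).measurableSet.inter hB
      have e : {c : Fin k.1 → P | (∀ i, c i ∈ ((k.2.1 i : Set P) ∩ B)) ∧ ∀ i i', π (c i) = π (c i')}
          = (⋂ i, (fun c : Fin k.1 → P => c i) ⁻¹' ((k.2.1 i : Set P) ∩ B)) ∩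
            ⋂ i, ⋂ i', {c : Fin k.1 → P | π (c i) = π (c i')} := by
        ext c
        simp only [Set.mem_inter_iff, Set.mem_iInter, Set.mem_preimage, Set.mem_ofPred_eq]
      rw [e]
      refine MeasurableSet.inter (MeasurableSet.iInter fun i => measurable_pi_apply i (hU i)) ?_
      refine MeasurableSet.iInter fun i => MeasurableSet.iInter fun i' => ?_
      exact measurableSet_eq_fun (hπ.measurable.comp (measurable_pi_apply i))
        (hπ.measurable.comp (measurable_pi_apply i'))
    · exact measurable_pi_apply _
  have hAmono : ∀ k B B', B ⊆ B' → A k B ⊆ A k B' := by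
    intro k B B' h
    apply Set.image_mono
    rintro c ⟨h1, h2⟩
    exact ⟨fun i => ⟨(h1 i).1, h (h1 i).2⟩, h2⟩
  let good : Set (Set P) → Prop := fun T => T.Countable ∧ (∀ t ∈ T, MeasurableSet t ∧ Set.InjOn π t)
  let Tm : Set K := {k | ∃ T, good T ∧ Set.InjOn π (A k (⋃₀ T)ᶜ)}
  have h1 : ∀ k : Tm, ∃ T, good T ∧ Set.InjOn π (A k (⋃₀ T)ᶜ) := fun k => k.2
  choose T hT hTinj using h1
  let T1 : Set (Set P) := ⋃ k, T k
  have hT1 : good T1 := by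
    refine ⟨Set.countable_iUnion fun k => (hT k).1, ?_⟩
    intro t ht
    obtain ⟨k, hk⟩ := Set.mem_iUnion.1 ht
    exact (hT k).2 t hk
  have hmeas : MeasurableSet (⋃₀ T1)ᶜ :=
    (MeasurableSet.sUnion hT1.1 fun t ht => (hT1.2 t ht).1).compl
  have h2 : ∀ k : Tm, ∃ B, MeasurableSet B ∧ A k (⋃₀ T1)ᶜ ⊆ B ∧ Set.InjOn π B := by
    intro k
    apply BR.analytic_injOn π hπ _ (hAan _ _ hmeas)
    refine (hTinj k).mono (hAmono _ _ _ ?_)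
    apply Set.compl_subset_compl.2
    exact Set.sUnion_subset_sUnion (Set.subset_iUnion T k)
  choose R hR1 hR2 hR3 using h2
  let T2 : Set (Set P) := T1 ∪ Set.range R
  have hT2 : good T2 := by
    refine ⟨hT1.1.union (Set.countable_range R), ?_⟩
    rintro t (ht | ⟨k, rfl⟩)
    · exact hT1.2 t ht
    · exact ⟨hR1 k, hR3 k⟩
  refine ⟨(⋃₀ T2)ᶜ, ?_, ?_⟩
  · rw [Set.nonempty_compl]
    intro h
    exact hno ⟨T2, hT2.1, hT2.2, h⟩
  · intro m c V j hcB hVo hcV hcπ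
    have : ∀ i, ∃ b : TopologicalSpace.countableBasis P, c i ∈ (b : Set P) ∧ (b : Set P) ⊆ V i := by
      intro i
      obtain ⟨b, hb1, hb2, hb3⟩ := hb.exists_subset_of_mem_open (hcV i) (hVo i)
      exact ⟨⟨b, hb1⟩, hb2, hb3⟩
    choose U hU1 hU2 using this
    let k : K := ⟨m, U, j⟩
    have hk : k ∉ Tm := by
      intro hk
      apply hcB j
      refine ⟨R ⟨k, hk⟩, Or.inr ⟨_, rfl⟩, ?_⟩
      apply hR2
      refine ⟨c, ⟨fun i => ⟨hU1 i, ?_⟩, hcπ⟩, rfl⟩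
      intro h
      exact hcB i (Set.sUnion_subset_sUnion Set.subset_union_left h)
    have hni : ¬ Set.InjOn π (A k (⋃₀ T2)ᶜ) := fun h => hk ⟨T2, hT2, h⟩
    simp only [Set.InjOn] at hni
    push Not at hni
    obtain ⟨_, ⟨d, ⟨hd1, hd2⟩, rfl⟩, _, ⟨e, ⟨he1, he2⟩, rfl⟩, hpi, hne⟩ := hni
    refine ⟨d, e j, fun i => ⟨(hd1 i).2, hU2 i (hd1 i).1⟩, fun i => ?_, (he1 j).2,
      hU2 j (he1 j).1, fun h => hne h.symm⟩
    rw [hd2 i j]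
    exact hpi

lemma BR.split_fintype {P X : Type*} [TopologicalSpace P] (π : P → X) (B : Set P)
    (hB : ∀ (m : ℕ) (c : Fin m → P) (V : Fin m → Set P) (j : Fin m),
      (∀ i, c i ∈ B) → (∀ i, IsOpen (V i)) → (∀ i, c i ∈ V i) → (∀ i i', π (c i) = π (c i')) →
      ∃ (c' : Fin m → P) (q : P), (∀ i, c' i ∈ B ∧ c' i ∈ V i) ∧ (∀ i, π (c' i) = π q) ∧
        q ∈ B ∧ q ∈ V j ∧ q ≠ c' j)
    {ι : Type} [Fintype ι] (c : ι → P) (V : ι → Set P) (j : ι)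
    (h1 : ∀ i, c i ∈ B) (h2 : ∀ i, IsOpen (V i)) (h3 : ∀ i, c i ∈ V i)
    (h4 : ∀ i i', π (c i) = π (c i')) :
      ∃ (c' : ι → P) (q : P), (∀ i, c' i ∈ B ∧ c' i ∈ V i) ∧ (∀ i, π (c' i) = π q) ∧
        q ∈ B ∧ q ∈ V j ∧ q ≠ c' j := by
  let e := Fintype.equivFin ι
  obtain ⟨c', q, a1, a2, a3, a4, a5⟩ := hB (Fintype.card ι) (c ∘ e.symm) (V ∘ e.symm) (e j)
    (fun i => h1 _) (fun i => h2 _) (fun i => h3 _) (fun i i' => h4 _ _)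
  refine ⟨c' ∘ e, q, fun i => ?_, fun i => a2 _, a3, by simpa using a4, a5⟩
  have := a1 (e i)
  simpa using this

lemma BR.split_all {P X : Type*} [TopologicalSpace P] [T2Space P] (π : P → X) (B : Set P)
    (hB : ∀ (m : ℕ) (c : Fin m → P) (V : Fin m → Set P) (j : Fin m),
      (∀ i, c i ∈ B) → (∀ i, IsOpen (V i)) → (∀ i, c i ∈ V i) → (∀ i i', π (c i) = π (c i')) →
      ∃ (c' : Fin m → P) (q : P), (∀ i, c' i ∈ B ∧ c' i ∈ V i) ∧ (∀ i, π (c' i) = π q) ∧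
        q ∈ B ∧ q ∈ V j ∧ q ≠ c' j)
    {ι : Type} [Fintype ι] (c : ι → P) (V : ι → Set P)
    (h1 : ∀ i, c i ∈ B) (h2 : ∀ i, IsOpen (V i)) (h3 : ∀ i, c i ∈ V i)
    (h4 : ∀ i i', π (c i) = π (c i')) :
      ∃ d : ι × Bool → P, (∀ i, d i ∈ B) ∧ (∀ i, d i ∈ V i.1) ∧ (∀ i i', π (d i) = π (d i')) ∧
        ∀ i, d (i, true) ≠ d (i, false) := by
  classical
  suffices H : ∀ S : Finset ι, ∃ d : ι × Bool → P, (∀ i, d i ∈ B) ∧ (∀ i, d i ∈ V i.1) ∧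
      (∀ i i', π (d i) = π (d i')) ∧ ∀ i ∈ S, d (i, true) ≠ d (i, false) by
    obtain ⟨d, a1, a2, a3, a4⟩ := H Finset.univ
    exact ⟨d, a1, a2, a3, fun i => a4 i (Finset.mem_univ i)⟩
  intro S
  induction S using Finset.induction_on with
  | empty => exact ⟨fun i => c i.1, fun i => h1 _, fun i => h3 _, fun i i' => h4 _ _, by simp⟩
  | insert j S hj ih =>
    obtain ⟨d, a1, a2, a3, a4⟩ := ih
    have hW : ∀ i : ι, ∃ W : Bool → Set P, (∀ b, IsOpen (W b)) ∧ (∀ b, d (i, b) ∈ W b) ∧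
        (i ∈ S → Disjoint (W true) (W false)) := by
      intro i
      by_cases hi : i ∈ S
      · obtain ⟨u, v, hu, hv, hdu, hdv, huv⟩ := t2_separation (a4 i hi)
        refine ⟨fun b => if b then u else v, ?_, ?_, ?_⟩
        · intro b; cases b <;> simpa
        · intro b; cases b <;> simpa
        · intro _; simpa using huv
      · exact ⟨fun _ => Set.univ, fun _ => isOpen_univ, fun _ => trivial, fun h => absurd h hi⟩
    choose W hW1 hW2 hW3 using hW
    obtain ⟨c', q, b1, b2, b3, b4, b5⟩ := BR.split_fintype π B hB d
      (fun i => V i.1 ∩ W i.1 i.2) (j, false) a1 (fun i => (h2 _).inter (hW1 _ _))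
      (fun i => ⟨a2 i, hW2 _ _⟩) a3
    refine ⟨fun i => if i = (j, true) then q else c' i, ?_, ?_, ?_, ?_⟩
    · intro i
      dsimp only
      split_ifs
      · exact b3
      · exact (b1 i).1
    · intro i
      dsimp only
      split_ifs with h
      · rw [h]; exact b4.1
      · exact (b1 i).2.1
    · have : ∀ i, π (if i = (j, true) then q else c' i) = π q := by
        intro i
        split_ifs
        · rfl
        · exact b2 i
      intro i i'
      rw [this, this]
    · intro i hi
      by_cases hij : i = j
      · subst hij
        simpa using b5
      · have hiS : i ∈ S := by
          rcases Finset.mem_insert.1 hi with h | h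
          · exact absurd h hij
          · exact h
        simp only [Prod.mk.injEq, hij, false_and, if_false]
        exact Set.disjoint_iff_forall_ne.1 (hW3 i hiS) (b1 (i, true)).2.2 (b1 (i, false)).2.2

/-- Lusin-Novikov, covering form. -/
lemma BR.lusin_novikov_cover {P X : Type*} [TopologicalSpace P] [PolishSpace P] [MeasurableSpace P]
    [BorelSpace P] [TopologicalSpace X] [PolishSpace X] [MeasurableSpace X] [BorelSpace X]
    (π : P → X) (hπ : Continuous π) (hc : ∀ x, (π ⁻¹' {x}).Countable) :
    ∃ T : Set (Set P), T.Countable ∧ (∀ t ∈ T, MeasurableSet t ∧ Set.InjOn π t) ∧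
      ⋃₀ T = Set.univ := by
  by_contra hno
  obtain ⟨B, ⟨p0, hp0⟩, hB⟩ := BR.splitting π hπ hno
  let := TopologicalSpace.upgradeIsCompletelyMetrizable P
  let St : ℕ → Type _ := fun n => {s : ((Fin n → Bool) → P) × ℝ //
    (∀ i, s.1 i ∈ B) ∧ (∀ i i', π (s.1 i) = π (s.1 i')) ∧ 0 < s.2}
  have hstep : ∀ n (s : St n), ∃ s' : St (n + 1),
      s'.1.2 ≤ s.1.2 / 2 ∧ (∀ i : Fin (n + 1) → Bool,
        dist (s'.1.1 i) (s.1.1 (fun k => i k.castSucc)) ≤ s.1.2 / 2) ∧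
      (∀ i i' : Fin (n + 1) → Bool, (∀ k : Fin n, i k.castSucc = i' k.castSucc) → i ≠ i' →
        2 * s'.1.2 < dist (s'.1.1 i) (s'.1.1 i')) := by
    rintro n ⟨⟨c, ε⟩, h1, h2, h3⟩
    obtain ⟨d, d1, d2, d3, d4⟩ := BR.split_all π B hB c (fun i => Metric.ball (c i) (ε / 2)) h1
      (fun i => Metric.isOpen_ball) (fun i => Metric.mem_ball_self (half_pos h3)) h2
    obtain ⟨δ, hδ0, hδ⟩ : ∃ δ > 0, ∀ i, δ < dist (d (i, true)) (d (i, false)) := by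
      have hev : ∀ᶠ δ in 𝓝[>] (0 : ℝ), ∀ i, δ < dist (d (i, true)) (d (i, false)) := by
        rw [eventually_all]
        intro i
        exact mem_nhdsWithin_of_mem_nhds (Iio_mem_nhds (dist_pos.2 (d4 i)))
      obtain ⟨δ, ha, hb⟩ := (hev.and self_mem_nhdsWithin).exists
      exact ⟨δ, hb, ha⟩
    refine ⟨⟨(fun i => d (fun k => i k.castSucc, i (Fin.last n)), min (ε / 2) (δ / 2)),
      fun i => d1 _, fun i i' => d3 _ _, lt_min (half_pos h3) (half_pos hδ0)⟩, min_le_left _ _,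
      fun i => (d2 _).le, ?_⟩
    intro i i' hk hne
    have e : (fun k : Fin n => i k.castSucc) = (fun k : Fin n => i' k.castSucc) := funext hk
    have hl : i (Fin.last n) ≠ i' (Fin.last n) := by
      intro hl
      apply hne
      funext k
      induction k using Fin.lastCases with
      | last => exact hl
      | cast k => exact hk k
    have hm : 2 * min (ε / 2) (δ / 2) ≤ δ := by
      have := min_le_right (ε / 2) (δ / 2)
      linarith
    refine lt_of_le_of_lt hm ?_
    dsimp only
    rw [e]
    cases h : i (Fin.last n) <;> cases h' : i' (Fin.last n)
    · simp [h, h'] at hl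
    · rw [dist_comm]; exact hδ _
    · exact hδ _
    · simp [h, h'] at hl
  choose next hn1 hn2 hn3 using hstep
  let s : ∀ n, St n := fun n => Nat.rec
    ⟨(fun _ => p0, 1), fun _ => hp0, fun _ _ => rfl, one_pos⟩ (fun n s => next n s) n
  have hs : ∀ n, s (n + 1) = next n (s n) := fun n => rfl
  let ε : ℕ → ℝ := fun n => (s n).1.2
  let r : (ℕ → Bool) → ∀ n, Fin n → Bool := fun α n k => α k
  let p : (ℕ → Bool) → ℕ → P := fun α n => (s n).1.1 (r α n)
  have hε0 : ∀ n, 0 < ε n := fun n => (s n).2.2.2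
  have hε : ∀ n, ε (n + 1) ≤ ε n / 2 := fun n => hn1 n (s n)
  have hpd : ∀ α n, dist (p α (n + 1)) (p α n) ≤ ε n / 2 := fun α n => hn2 n (s n) (r α (n + 1))
  have hball : ∀ α n k, dist (p α (n + k)) (p α n) ≤ ε n - ε (n + k) := by
    intro α n k
    induction k with
    | zero => simp
    | succ k ih =>
      have h1 := hpd α (n + k)
      have h2 := hε (n + k)
      have h3 := dist_triangle (p α (n + k + 1)) (p α (n + k)) (p α n)
      rw [← add_assoc]
      linarith
  have hεle : ∀ n, ε n ≤ (1 / 2) ^ n := by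
    intro n
    induction n with
    | zero => simp [ε, s]
    | succ n ih =>
      have := hε n
      rw [pow_succ]
      linarith
  have hlim : ∀ α, ∃ x, Tendsto (p α) atTop (𝓝 x) := by
    intro α
    apply cauchySeq_tendsto_of_complete
    apply cauchySeq_of_le_geometric (1 / 2) 1 (by norm_num)
    intro n
    have h1 := hpd α n
    have h2 := hεle n
    have h3 := hε0 n
    rw [dist_comm]
    linarith
  choose f hf using hlim
  have hfb : ∀ α n, dist (f α) (p α n) ≤ ε n := by
    intro α n
    refine le_of_tendsto ((hf α).dist tendsto_const_nhds) ?_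
    filter_upwards [eventually_ge_atTop n] with m hm
    obtain ⟨k, rfl⟩ := Nat.exists_eq_add_of_le hm
    have := hball α n k
    have := hε0 (n + k)
    linarith
  have hfinj : Function.Injective f := by
    intro α β hαβ
    by_contra hne
    have hex : ∃ n, α n ≠ β n := by
      by_contra h
      push Not at h
      exact hne (funext h)
    have hlt := Nat.find_spec hex
    have hmin := fun m hm => not_not.1 (Nat.find_min hex (m := m) hm)
    set n := Nat.find hex
    have h1 := hn3 n (s n) (r α (n + 1)) (r β (n + 1)) (fun k => hmin _ k.2) (fun h => hlt (by
      have := congrFun h (Fin.last n)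
      simpa [r] using this))
    have h2 := hfb α (n + 1)
    have h3 := hfb β (n + 1)
    rw [hαβ] at h2
    have h4 := dist_triangle_left (p α (n + 1)) (p β (n + 1)) (f β)
    change 2 * ε (n + 1) < dist (p α (n + 1)) (p β (n + 1)) at h1
    linarith
  let α0 : ℕ → Bool := fun _ => true
  have hfib : ∀ α, f α ∈ π ⁻¹' {π (f α0)} := by
    intro α
    refine tendsto_nhds_unique ((hπ.tendsto _).comp (hf α)) ?_
    refine ((hπ.tendsto _).comp (hf α0)).congr ?_
    intro n
    exact (s n).2.2.1 _ _
  have hcnt : (Set.univ : Set (ℕ → Bool)).Countable := by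
    have := ((hc (π (f α0))).preimage hfinj)
    refine this.mono ?_
    intro α _
    exact hfib α
  have : Countable (ℕ → Bool) := Set.countable_univ_iff.1 hcnt
  obtain ⟨e, he⟩ := exists_injective_nat (ℕ → Bool)
  refine Function.cantor_injective (α := ℕ) (fun S => e fun n => @decide (n ∈ S) (propDecidable _)) ?_
  intro S S' h
  have := he h
  ext n
  have := congrFun this n
  simpa using this

/-- Refining a Polish topology of a standard Borel space so that a measurable map becomes
continuous. -/
lemma BR.exists_top {P X : Type*} [mP : MeasurableSpace P] [StandardBorelSpace P]
    [TopologicalSpace X] [SecondCountableTopology X] [MeasurableSpace X] [BorelSpace X]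
    (π : P → X) (hπ : Measurable π) (t0 : TopologicalSpace P) (h0 : @PolishSpace P t0)
    (hb : @BorelSpace P t0 mP) :
    ∃ t : TopologicalSpace P, t ≤ t0 ∧ @PolishSpace P t ∧ @BorelSpace P t mP ∧
      Continuous[t, _] π := by
  obtain ⟨t', hle, hcont, hpol⟩ := hπ.exists_continuous
  refine ⟨t', hle, hpol, ⟨?_⟩, hcont⟩
  rw [borel_eq_borel_of_le hpol h0 hle]
  exact hb.measurable_eq

lemma BR.cover_std {P X : Type*} [MeasurableSpace P] [StandardBorelSpace P]
    [MeasurableSpace X] [StandardBorelSpace X]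
    (π : P → X) (hπ : Measurable π) (hc : ∀ x, (π ⁻¹' {x}).Countable) :
    ∃ T : Set (Set P), T.Countable ∧ (∀ t ∈ T, MeasurableSet t ∧ Set.InjOn π t) ∧
      ⋃₀ T = Set.univ := by
  let := upgradeStandardBorel X
  have h1 : ∃ t : TopologicalSpace P, @PolishSpace P t ∧ @BorelSpace P t _ := by
    let := upgradeStandardBorel P
    exact ⟨inferInstance, inferInstance, inferInstance⟩
  obtain ⟨t0, h0, hb⟩ := h1
  obtain ⟨t, -, ht1, ht2, ht3⟩ := BR.exists_top π hπ t0 h0 hb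
  exact BR.lusin_novikov_cover π ht3 hc

lemma BR.exists_functions {X : Type*} [MeasurableSpace X] [StandardBorelSpace X]
    (E : X → X → Prop) (hE : Equivalence E)
    (hEBorel : MeasurableSet {p : X × X | E p.1 p.2})
    (hcount : ∀ x : X, {y | E x y}.Countable) :
    ∃ g : ℕ → X → X, (∀ i, Measurable (g i)) ∧ (∀ i x, E x (g i x)) ∧
      (∀ x y, E x y → ∃ i, g i x = y) ∧ (∃ i, g i = id) ∧ ∀ i j, ∃ k, g k = g i ∘ g j := by
  let P := {p : X × X // E p.1 p.2}
  have : StandardBorelSpace P := hEBorel.standardBorel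
  let π : P → X := fun p => p.1.1
  let ρ : P → X := fun p => p.1.2
  have hπ : Measurable π := measurable_fst.comp measurable_subtype_coe
  have hρ : Measurable ρ := measurable_snd.comp measurable_subtype_coe
  obtain ⟨T, hT1, hT2, hT3⟩ := BR.cover_std π hπ (by
    intro x
    have : Set.InjOn ρ (π ⁻¹' {x}) := by
      rintro ⟨⟨a, b⟩, h⟩ hp ⟨⟨a', b'⟩, h'⟩ hq hpq
      have e1 : a = x := hp
      have e2 : a' = x := hq
      have e3 : b = b' := hpq
      subst e1 e2 e3
      rfl
    refine Set.countable_of_injective_of_countable_image this ((hcount x).mono ?_)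
    rintro _ ⟨p, hp, rfl⟩
    have e1 : p.1.1 = x := hp
    rw [← e1]
    exact p.2)
  have hf : ∀ t : T, ∃ f : X → X, Measurable f ∧ (∀ x, E x (f x)) ∧
      ∀ p ∈ t.1, f (π p) = ρ p := by
    rintro ⟨t, ht⟩
    obtain ⟨htm, hti⟩ := hT2 t ht
    let f : X → X := fun x => if h : ∃ p ∈ t, π p = x then ρ h.choose else x
    have hfp : ∀ p ∈ t, f (π p) = ρ p := by
      intro p hp
      have h : ∃ q ∈ t, π q = π p := ⟨p, hp, rfl⟩
      have e : h.choose = p := hti h.choose_spec.1 hp h.choose_spec.2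
      simp only [f, dif_pos h, e]
    have hfn : ∀ x, x ∉ π '' t → f x = x := by
      intro x hx
      exact dif_neg hx
    refine ⟨f, ?_, ?_, hfp⟩
    · intro V hV
      have e : f ⁻¹' V = (π '' (t ∩ ρ ⁻¹' V)) ∪ (V \ π '' t) := by
        ext x
        by_cases hx : x ∈ π '' t
        · obtain ⟨p, hp, rfl⟩ := hx
          constructor
          · intro h
            left
            refine ⟨p, ⟨hp, ?_⟩, rfl⟩
            rw [Set.mem_preimage, hfp p hp] at h
            exact h
          · rintro (⟨q, ⟨hq1, hq2⟩, hq3⟩ | h)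
            · have := hti hq1 hp hq3
              subst this
              rw [Set.mem_preimage, hfp q hp]
              exact hq2
            · exact absurd ⟨p, hp, rfl⟩ h.2
        · rw [Set.mem_preimage, hfn x hx]
          constructor
          · intro h
            exact Or.inr ⟨h, hx⟩
          · rintro (⟨q, ⟨hq1, hq2⟩, hq3⟩ | h)
            · exact absurd ⟨q, hq1, hq3⟩ hx
            · exact h.1
      rw [e]
      refine MeasurableSet.union ?_ (hV.diff ?_)
      · exact (htm.inter (hρ hV)).image_of_measurable_injOn hπ (hti.mono Set.inter_subset_left)
      · exact htm.image_of_measurable_injOn hπ hti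
    · intro x
      by_cases hx : x ∈ π '' t
      · obtain ⟨p, hp, rfl⟩ := hx
        rw [hfp p hp]
        exact p.2
      · rw [hfn x hx]
        exact hE.refl x
  choose f hf1 hf2 hf3 using hf
  have : Countable T := hT1.to_subtype
  let G : List T → X → X := fun L => L.foldr (fun t h => f t ∘ h) id
  have hGm : ∀ L, Measurable (G L) := by
    intro L
    induction L with
    | nil => exact measurable_id
    | cons t L ih => exact (hf1 t).comp ih
  have hGE : ∀ L x, E x (G L x) := by
    intro L x
    induction L with
    | nil => exact hE.refl x
    | cons t L ih => exact hE.trans ih (hf2 t _)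
  have hGc : ∀ L L', G (L ++ L') = G L ∘ G L' := by
    intro L L'
    induction L with
    | nil => rfl
    | cons t L ih =>
      change f t ∘ G (L ++ L') = (f t ∘ G L) ∘ G L'
      rw [ih]; rfl
  obtain ⟨e, he⟩ := exists_surjective_nat (List T)
  refine ⟨fun i => G (e i), fun i => hGm _, fun i x => hGE _ x, ?_, ?_, ?_⟩
  · intro x y hxy
    have hp : (⟨(x, y), hxy⟩ : P) ∈ ⋃₀ T := by rw [hT3]; trivial
    obtain ⟨t, ht, hp⟩ := hp
    obtain ⟨i, hi⟩ := he [⟨t, ht⟩]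
    refine ⟨i, ?_⟩
    dsimp only
    rw [hi]
    exact hf3 ⟨t, ht⟩ _ hp
  · obtain ⟨i, hi⟩ := he []
    exact ⟨i, by dsimp only; rw [hi]; rfl⟩
  · intro i j
    obtain ⟨k, hk⟩ := he (e i ++ e j)
    exact ⟨k, by dsimp only; rw [hk, hGc]⟩

/-- The ideal of sets contained in the saturation of countably many Borel partial transversals. -/
def BR.Small {X : Type*} [MeasurableSpace X] (E : X → X → Prop) (A : Set X) : Prop :=
  ∃ T : Set (Set X), T.Countable ∧
    (∀ t ∈ T, MeasurableSet t ∧ ∀ x ∈ t, ∀ y ∈ t, E x y → x = y) ∧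
    ∀ x ∈ A, ∃ t ∈ T, ∃ y ∈ t, E x y

lemma BR.Small.iUnion {X : Type*} [MeasurableSpace X] {E : X → X → Prop} {ι : Sort*} [Countable ι]
    {A : ι → Set X} (h : ∀ i, BR.Small E (A i)) : BR.Small E (⋃ i, A i) := by
  choose T hT1 hT2 hT3 using h
  refine ⟨⋃ i, T i, Set.countable_iUnion hT1, ?_, ?_⟩
  · intro t ht
    obtain ⟨i, hi⟩ := Set.mem_iUnion.1 ht
    exact hT2 i t hi
  · intro x hx
    obtain ⟨i, hi⟩ := Set.mem_iUnion.1 hx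
    obtain ⟨t, ht, h⟩ := hT3 i x hi
    exact ⟨t, Set.mem_iUnion.2 ⟨i, ht⟩, h⟩

lemma BR.Small.mono {X : Type*} [MeasurableSpace X] {E : X → X → Prop} {A B : Set X}
    (h : BR.Small E B) (hAB : A ⊆ B) : BR.Small E A := by
  obtain ⟨T, h1, h2, h3⟩ := h
  exact ⟨T, h1, h2, fun x hx => h3 x (hAB hx)⟩

lemma BR.Small.union {X : Type*} [MeasurableSpace X] {E : X → X → Prop} {A B : Set X}
    (hA : BR.Small E A) (hB : BR.Small E B) : BR.Small E (A ∪ B) := by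
  rw [Set.union_eq_iUnion]
  exact BR.Small.iUnion (fun i => by cases i <;> assumption)

/-- If the whole space is small then `E` is smooth. -/
lemma BR.smooth_of_small {X : Type*} [MeasurableSpace X] [StandardBorelSpace X]
    (E : X → X → Prop) (hE : Equivalence E)
    (g : ℕ → X → X) (hgm : ∀ i, Measurable (g i)) (hgE : ∀ i x, E x (g i x))
    (hgs : ∀ x y, E x y → ∃ i, g i x = y)
    (hS : BR.Small E (Set.univ : Set X)) : IsSmooth E := by
  obtain ⟨T, hT1, hT2, hT3⟩ := hS
  obtain hemp | hne := isEmpty_or_nonempty X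
  · exact ⟨ℝ, inferInstance, inferInstance, fun _ => 0, measurable_const, fun x => hemp.elim x⟩
  have hTn : T.Nonempty := by
    obtain ⟨t, ht, -⟩ := hT3 (Classical.arbitrary X) trivial
    exact ⟨t, ht⟩
  obtain ⟨τ, hτ⟩ := hT1.exists_eq_range hTn
  have hτT : ∀ i, τ i ∈ T := fun i => hτ ▸ Set.mem_range_self i
  -- first `m` coding a pair `(j, i)` with `g i x ∈ τ j`
  let p : ℕ → X → Prop := fun m x => g (Nat.unpair m).2 x ∈ τ (Nat.unpair m).1
  have hp : ∀ x, ∃ m, p m x := by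
    intro x
    obtain ⟨t, ht, y, hy, hxy⟩ := hT3 x trivial
    rw [hτ] at ht
    obtain ⟨j, rfl⟩ := ht
    obtain ⟨i, rfl⟩ := hgs x y hxy
    exact ⟨Nat.pair j i, by simpa [p] using hy⟩
  -- first index `j` such that the class meets `τ j`
  let P : X → ℕ → Prop := fun x j => ∃ i, g i x ∈ τ j
  have hP : ∀ x, ∃ j, P x j := by
    intro x
    obtain ⟨m, hm⟩ := hp x
    exact ⟨_, _, hm⟩
  let Q : X → ℕ → Prop := fun x i => g i x ∈ τ (Nat.find (hP x))
  have hQ : ∀ x, ∃ i, Q x i := fun x => Nat.find_spec (hP x)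
  have hJ : Measurable fun x => Nat.find (hP x) := by
    apply measurable_find
    intro j
    have : {x | P x j} = ⋃ i, (g i) ⁻¹' τ j := by
      ext x
      simp [P]
    rw [this]
    exact MeasurableSet.iUnion fun i => hgm i (hT2 _ (hτT j)).1
  have hI : Measurable fun x => Nat.find (hQ x) := by
    apply measurable_find
    intro i
    have : {x | Q x i} = ⋃ j, ((fun x => Nat.find (hP x)) ⁻¹' {j}) ∩ (g i) ⁻¹' τ j := by
      ext x
      simp [Q]
    rw [this]
    exact MeasurableSet.iUnion fun j => (hJ (MeasurableSet.singleton j)).inter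
      (hgm i (hT2 _ (hτT j)).1)
  let F : X → X := fun x => g (Nat.find (hQ x)) x
  have hF : Measurable F := by
    have h : Measurable fun q : ℕ × X => g q.1 q.2 := measurable_from_prod_countable_right hgm
    exact h.comp (hI.prodMk measurable_id)
  have hFE : ∀ x, E x (F x) := fun x => hgE _ _
  have hFτ : ∀ x, F x ∈ τ (Nat.find (hP x)) := fun x => Nat.find_spec (hQ x)
  have hJE : ∀ x y, E x y → Nat.find (hP x) = Nat.find (hP y) := by
    have key : ∀ x y, E x y → Nat.find (hP x) ≤ Nat.find (hP y) := by
      intro x y hxy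
      apply Nat.find_min'
      obtain ⟨i, hi⟩ := Nat.find_spec (hP y)
      obtain ⟨k, hk⟩ := hgs x _ (hE.trans hxy (hgE i y))
      exact ⟨k, by rw [hk]; exact hi⟩
    intro x y hxy
    exact le_antisymm (key x y hxy) (key y x (hE.symm hxy))
  refine ⟨ℝ, inferInstance, inferInstance, fun x => embeddingReal X (F x),
    (measurable_embeddingReal X).comp hF, fun x y => ⟨fun h => ?_, fun h => ?_⟩⟩
  · have : F x = F y := by
      refine (hT2 _ (hτT (Nat.find (hP x)))).2 _ (hFτ x) _ ?_ ?_
      · rw [hJE x y h]; exact hFτ y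
      · exact hE.trans (hE.symm (hFE x)) (hE.trans h (hFE y))
    dsimp only
    rw [this]
  · have : F x = F y := (measurableEmbedding_embeddingReal X).injective h
    have h2 := hFE y
    rw [← this] at h2
    exact hE.trans (hFE x) (hE.symm h2)

lemma BR.step {X : Type*} [MeasurableSpace X] [StandardBorelSpace X] [MetricSpace X]
    [SecondCountableTopology X] [BorelSpace X]
    (E : X → X → Prop) (hE : Equivalence E)
    (g : ℕ → X → X) (hgm : ∀ i, Measurable (g i)) (hgE : ∀ i x, E x (g i x))
    (hgs : ∀ x y, E x y → ∃ i, g i x = y)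
    (A : Set X) (hAm : MeasurableSet A) (hAs : ¬ BR.Small E A)
    (W : Set (X → X)) (hWf : W.Finite) (hWm : ∀ w ∈ W, Measurable w)
    (hWi : ∀ w ∈ W, Set.InjOn w A)
    (F : Set (X → X)) (hFf : F.Finite) (hFc : ∀ f ∈ F, IsClosed {p : X × X | f p.1 = p.2})
    (ε : ℝ) (hε : 0 < ε) :
    ∃ (i : ℕ) (A' : Set X), A' ⊆ A ∧ MeasurableSet A' ∧ ¬ BR.Small E A' ∧
      Set.MapsTo (g i) A' A ∧ Set.InjOn (g i) A' ∧
      (∀ w ∈ W, ∀ x ∈ A', ∀ y ∈ A', dist (w x) (w y) ≤ ε) ∧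
      (∀ w ∈ W, ∀ x ∈ A', ∀ y ∈ A', dist (w (g i x)) (w (g i y)) ≤ ε) ∧
      (∀ u ∈ W, ∀ v ∈ W, ∀ f ∈ F, ∀ a ∈ closure (u '' A'), ∀ b ∈ closure ((v ∘ g i) '' A'),
        f a ≠ b) := by
  by_contra hcon
  let Bs := TopologicalSpace.countableBasis X
  have hb := TopologicalSpace.isBasis_countableBasis X
  have : Countable Bs := (TopologicalSpace.countable_countableBasis X).to_subtype
  have : Finite W := hWf.to_subtype
  let good : ((W → Bs) × (W → Bs)) → Prop := fun k =>
    (∀ w : W, ∀ x ∈ (k.1 w : Set X), ∀ y ∈ (k.1 w : Set X), dist x y ≤ ε) ∧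
    (∀ w : W, ∀ x ∈ (k.2 w : Set X), ∀ y ∈ (k.2 w : Set X), dist x y ≤ ε) ∧
    (∀ u v : W, ∀ f ∈ F, ∀ a ∈ closure (k.1 u : Set X), ∀ b ∈ closure (k.2 v : Set X), f a ≠ b)
  let K := ℕ × ℕ × {k : (W → Bs) × (W → Bs) // good k}
  let A' : K → Set X := fun k => {x | x ∈ A ∧ g k.1 x ∈ A ∧ g k.2.1 (g k.1 x) = x ∧
    (∀ w : W, w.1 x ∈ (k.2.2.1.1 w : Set X)) ∧ ∀ w : W, w.1 (g k.1 x) ∈ (k.2.2.1.2 w : Set X)}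
  have hA'm : ∀ k, MeasurableSet (A' k) := by
    intro k
    have e : A' k = A ∩ ((g k.1) ⁻¹' A ∩ ({x | g k.2.1 (g k.1 x) = x} ∩
      ((⋂ w : W, w.1 ⁻¹' (k.2.2.1.1 w : Set X)) ∩
        ⋂ w : W, (fun x => w.1 (g k.1 x)) ⁻¹' (k.2.2.1.2 w : Set X)))) := by
      ext x
      simp only [A', Set.mem_inter_iff, Set.mem_iInter, Set.mem_preimage, Set.mem_ofPred_eq]
    rw [e]
    refine hAm.inter ((hgm _ hAm).inter (MeasurableSet.inter ?_ (MeasurableSet.inter ?_ ?_)))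
    · exact measurableSet_eq_fun ((hgm _).comp (hgm _)) measurable_id
    · exact MeasurableSet.iInter fun w => hWm w.1 w.2 (hb.isOpen (k.2.2.1.1 w).2).measurableSet
    · exact MeasurableSet.iInter fun w =>
        ((hWm w.1 w.2).comp (hgm _)) (hb.isOpen (k.2.2.1.2 w).2).measurableSet
  have hsm : ∀ k, BR.Small E (A' k) := by
    intro k
    by_contra hk
    obtain ⟨i, j, ⟨⟨U, U'⟩, hg1, hg2, hg3⟩⟩ := k
    refine hcon ⟨i, _, fun x hx => hx.1, hA'm _, hk, fun x hx => hx.2.1, ?_, ?_, ?_, ?_⟩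
    · intro x hx y hy hxy
      have h1 := hx.2.2.1
      have h2 := hy.2.2.1
      dsimp only at h1 h2
      rw [← h1, ← h2, hxy]
    · intro w hw x hx y hy
      exact hg1 ⟨w, hw⟩ _ (hx.2.2.2.1 ⟨w, hw⟩) _ (hy.2.2.2.1 ⟨w, hw⟩)
    · intro w hw x hx y hy
      exact hg2 ⟨w, hw⟩ _ (hx.2.2.2.2 ⟨w, hw⟩) _ (hy.2.2.2.2 ⟨w, hw⟩)
    · intro u hu v hv f hf a ha b hb
      refine hg3 ⟨u, hu⟩ ⟨v, hv⟩ f hf a (closure_mono ?_ ha) b (closure_mono ?_ hb)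
      · rintro _ ⟨x, hx, rfl⟩
        exact hx.2.2.2.1 ⟨u, hu⟩
      · rintro _ ⟨x, hx, rfl⟩
        exact hx.2.2.2.2 ⟨v, hv⟩
  let r := embeddingReal X
  have hr : Measurable r := measurable_embeddingReal X
  have hri : Function.Injective r := (measurableEmbedding_embeddingReal X).injective
  let T : Set X := {x | x ∈ A ∧ ∀ i, g i x ∈ A → r x ≤ r (g i x)}
  have hTm : MeasurableSet T := by
    have e : T = A ∩ ⋂ i, ((g i) ⁻¹' Aᶜ ∪ {x | r x ≤ r (g i x)}) := by
      ext x
      simp only [T, Set.mem_inter_iff, Set.mem_iInter, Set.mem_union, Set.mem_preimage,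
        Set.mem_ofPred_eq, Set.mem_compl_iff, imp_iff_not_or]
    rw [e]
    exact hAm.inter (MeasurableSet.iInter fun i => (hgm i hAm.compl).union
      (measurableSet_le hr (hr.comp (hgm i))))
  have hTs : BR.Small E {x | ∃ y ∈ T, E x y} := by
    refine ⟨{T}, Set.countable_singleton T, ?_, fun x hx => ⟨T, rfl, hx⟩⟩
    rintro t rfl
    refine ⟨hTm, fun x hx y hy hxy => ?_⟩
    obtain ⟨i, hi⟩ := hgs x y hxy
    obtain ⟨j, hj⟩ := hgs y x (hE.symm hxy)
    have h1 := hx.2 i (by rw [hi]; exact hy.1)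
    have h2 := hy.2 j (by rw [hj]; exact hx.1)
    rw [hi] at h1
    rw [hj] at h2
    exact hri (le_antisymm h1 h2)
  apply hAs
  refine (hTs.union (BR.Small.iUnion hsm)).mono ?_
  intro x hxA
  by_cases hxT : ∃ y ∈ T, E x y
  · exact Or.inl hxT
  right
  have hinf : {y | y ∈ A ∧ E x y}.Infinite := by
    intro hfin
    obtain ⟨t, ht1, ht2⟩ := Set.exists_min_image _ r hfin ⟨x, hxA, hE.refl x⟩
    exact hxT ⟨t, ⟨ht1.1, fun i hi => ht2 _ ⟨hi, hE.trans ht1.2 (hgE i t)⟩⟩, ht1.2⟩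
  have hbad : (⋃ u ∈ W, ⋃ v ∈ W, ⋃ f ∈ F, {y | y ∈ A ∧ v y = f (u x)}).Finite := by
    refine hWf.biUnion fun u hu => hWf.biUnion fun v hv => hFf.biUnion fun f hf => ?_
    apply Set.Subsingleton.finite
    intro y hy z hz
    exact hWi v hv hy.1 hz.1 (hy.2.trans hz.2.symm)
  obtain ⟨y, ⟨hyA, hxy⟩, hyb⟩ := (hinf.sdiff hbad).nonempty
  have hyb' : ∀ u ∈ W, ∀ v ∈ W, ∀ f ∈ F, f (u x) ≠ v y := by
    intro u hu v hv f hf h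
    apply hyb
    simp only [Set.mem_iUnion]
    exact ⟨u, hu, v, hv, f, hf, hyA, h.symm⟩
  have hδ : ∀ᶠ δ in 𝓝[>] (0 : ℝ), ∀ u ∈ W, ∀ v ∈ W, ∀ f ∈ F, ∀ a b, dist a (u x) ≤ δ →
      dist b (v y) ≤ δ → f a ≠ b := by
    rw [eventually_all_finite hWf]
    intro u hu
    rw [eventually_all_finite hWf]
    intro v hv
    rw [eventually_all_finite hFf]
    intro f hf
    have hop := (hFc f hf).isOpen_compl
    have hmem : (u x, v y) ∈ {p : X × X | f p.1 = p.2}ᶜ := hyb' u hu v hv f hf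
    obtain ⟨η, hη, hball⟩ := Metric.isOpen_iff.1 hop _ hmem
    filter_upwards [mem_nhdsWithin_of_mem_nhds (Iio_mem_nhds hη)] with δ hδ a b ha hb hab
    refine hball (show (a, b) ∈ Metric.ball (u x, v y) η from ?_) hab
    rw [Metric.mem_ball, Prod.dist_eq]
    exact max_lt (lt_of_le_of_lt ha hδ) (lt_of_le_of_lt hb hδ)
  obtain ⟨δ, ⟨hδ1, hδ2⟩, hδ0⟩ := ((hδ.and (mem_nhdsWithin_of_mem_nhds
    (Iio_mem_nhds (half_pos hε)))).and self_mem_nhdsWithin).exists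
  have hδ0' : (0 : ℝ) < δ := hδ0
  have hδ2' : δ < ε / 2 := hδ2
  have hU : ∀ p : X, ∃ b : Bs, p ∈ (b : Set X) ∧ (b : Set X) ⊆ Metric.ball p δ := by
    intro p
    obtain ⟨b, hb1, hb2, hb3⟩ := hb.exists_subset_of_mem_open (Metric.mem_ball_self hδ0')
      Metric.isOpen_ball
    exact ⟨⟨b, hb1⟩, hb2, hb3⟩
  choose U hU1 hU2 using hU
  have hUd : ∀ p : X, ∀ a ∈ (U p : Set X), ∀ b ∈ (U p : Set X), dist a b ≤ ε := by
    intro p a ha b hb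
    have h1 : dist a p < δ := hU2 p ha
    have h2 : dist b p < δ := hU2 p hb
    have := dist_triangle_right a b p
    linarith
  have hUc : ∀ p : X, ∀ a ∈ closure (U p : Set X), dist a p ≤ δ := by
    intro p a ha
    exact Metric.closure_ball_subset_closedBall (closure_mono (hU2 p) ha)
  obtain ⟨i, hi⟩ := hgs x y hxy
  obtain ⟨j, hj⟩ := hgs y x (hE.symm hxy)
  rw [Set.mem_iUnion]
  refine ⟨⟨i, j, ⟨(fun w => U (w.1 x), fun w => U (w.1 y)), fun w => hUd _, fun w => hUd _,
    fun u v f hf a ha b hb => hδ1 u.1 u.2 v.1 v.2 f hf a b (hUc _ _ ha) (hUc _ _ hb)⟩⟩,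
    hxA, ?_, ?_, ?_, ?_⟩
  · dsimp only; rw [hi]; exact hyA
  · dsimp only; rw [hi, hj]
  · intro w; exact hU1 _
  · intro w; dsimp only; rw [hi]; exact hU1 _

lemma BR.embedding_top {X : Type*} [MeasurableSpace X] [StandardBorelSpace X] [TopologicalSpace X]
    [PolishSpace X] [BorelSpace X]
    (E : X → X → Prop) (hE : Equivalence E)
    (g : ℕ → X → X) (hgm : ∀ i, Measurable (g i)) (hgE : ∀ i x, E x (g i x))
    (hgs : ∀ x y, E x y → ∃ i, g i x = y) (hgid : ∃ i, g i = id)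
    (hgc : ∀ i j, ∃ k, g k = g i ∘ g j)
    (hcl : ∀ i, IsClosed {p : X × X | g i p.1 = p.2})
    (hns : ¬ BR.Small E (Set.univ : Set X)) :
    ∃ φ : (ℕ → ZMod 2) → X, Measurable φ ∧ Function.Injective φ ∧
      ∀ a b, E (φ a) (φ b) ↔ {n | a n ≠ b n}.Finite := by
  let := TopologicalSpace.upgradeIsCompletelyMetrizable X
  obtain ⟨i0, hi0⟩ := hgid
  let St := {s : Set X × Set (X → X) // MeasurableSet s.1 ∧ ¬ BR.Small E s.1 ∧ s.2.Finite ∧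
    ∀ w ∈ s.2, (∃ i, w = g i) ∧ Set.InjOn w s.1}
  have hstep : ∀ (n : ℕ) (s : St), ∃ (i : ℕ) (s' : St), s'.1.1 ⊆ s.1.1 ∧
      Set.MapsTo (g i) s'.1.1 s.1.1 ∧
      s'.1.2 = s.1.2 ∪ (fun w => w ∘ g i) '' s.1.2 ∧
      (∀ w ∈ s'.1.2, ∀ x ∈ s'.1.1, ∀ y ∈ s'.1.1, dist (w x) (w y) ≤ (1 / 2) ^ n) ∧
      (∀ u ∈ s.1.2, ∀ v ∈ s.1.2, ∀ j ≤ n + i0, ∀ a ∈ closure (u '' s'.1.1),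
        ∀ b ∈ closure ((v ∘ g i) '' s'.1.1), g j a ≠ b) := by
    rintro n ⟨⟨A, W⟩, h1, h2, h3, h4⟩
    obtain ⟨i, A', b1, b2, b3, b4, b5, b6, b7, b8⟩ := BR.step E hE g hgm hgE hgs A h1 h2 W h3
      (fun w hw => by obtain ⟨i, rfl⟩ := (h4 w hw).1; exact hgm i)
      (fun w hw => (h4 w hw).2) (g '' Set.Iic (n + i0)) ((Set.finite_Iic (n + i0)).image g)
      (by rintro _ ⟨j, -, rfl⟩; exact hcl j) ((1 / 2) ^ n) (by positivity)
    refine ⟨i, ⟨(A', W ∪ (fun w => w ∘ g i) '' W), b2, b3, h3.union (h3.image _), ?_⟩, b1, b4, rfl,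
      ?_, ?_⟩
    · rintro w (hw | ⟨w, hw, rfl⟩)
      · exact ⟨(h4 w hw).1, (h4 w hw).2.mono b1⟩
      · refine ⟨?_, (h4 w hw).2.comp b5 b4⟩
        obtain ⟨j, rfl⟩ := (h4 w hw).1
        obtain ⟨k, hk⟩ := hgc j i
        exact ⟨k, hk.symm⟩
    · rintro w (hw | ⟨w, hw, rfl⟩)
      · exact b6 w hw
      · exact b7 w hw
    · intro u hu v hv j hj
      exact b8 u hu v hv (g j) ⟨j, hj, rfl⟩
  choose ix next hn1 hn2 hn3 hn4 hn5 using hstep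
  let s : ℕ → St := fun n => Nat.rec
    ⟨(Set.univ, {id}), MeasurableSet.univ, hns, Set.finite_singleton _, by
      rintro w rfl
      exact ⟨⟨i0, hi0.symm⟩, Set.injOn_id _⟩⟩ (fun n s => next n s) n
  let A : ℕ → Set X := fun n => (s n).1.1
  let W : ℕ → Set (X → X) := fun n => (s n).1.2
  let h : ℕ → X → X := fun n => g (ix n (s n))
  have hA1 : ∀ n, A (n + 1) ⊆ A n := fun n => hn1 n (s n)
  have hA2 : ∀ n, Set.MapsTo (h n) (A (n + 1)) (A n) := fun n => hn2 n (s n)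
  have hW : ∀ n, W (n + 1) = W n ∪ (fun w => w ∘ h n) '' W n := fun n => hn3 n (s n)
  have hd : ∀ n, ∀ w ∈ W (n + 1), ∀ x ∈ A (n + 1), ∀ y ∈ A (n + 1),
    dist (w x) (w y) ≤ (1 / 2) ^ n := fun n => hn4 n (s n)
  have hsep : ∀ n, ∀ u ∈ W n, ∀ v ∈ W n, ∀ j ≤ n + i0, ∀ a ∈ closure (u '' A (n + 1)),
        ∀ b ∈ closure ((v ∘ h n) '' A (n + 1)), g j a ≠ b := fun n => hn5 n (s n)
  have hWg : ∀ n, ∀ w ∈ W n, ∃ i, w = g i := fun n w hw => ((s n).2.2.2.2 w hw).1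
  have hAne : ∀ n, (A n).Nonempty := by
    intro n
    rw [Set.nonempty_iff_ne_empty]
    intro he
    apply (s n).2.2.1
    change BR.Small E (A n)
    rw [he]
    exact ⟨∅, Set.countable_empty, by simp, by simp⟩
  choose x hx using hAne
  let w : (ℕ → ZMod 2) → ℕ → X → X := fun α n =>
    Nat.rec id (fun n w => if α n = 0 then w else w ∘ h n) n
  have hw0 : ∀ α, w α 0 = id := fun α => rfl
  have hws : ∀ α n, w α (n + 1) = if α n = 0 then w α n else w α n ∘ h n := fun α n => rfl
  have hwW : ∀ α n, w α n ∈ W n := by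
    intro α n
    induction n with
    | zero => exact rfl
    | succ n ih =>
      rw [hws, hW]
      split_ifs
      · exact Or.inl ih
      · exact Or.inr ⟨_, ih, rfl⟩
  let C : (ℕ → ZMod 2) → ℕ → Set X := fun α n => w α n '' A n
  have hCa : ∀ α, Antitone (C α) := by
    intro α
    apply antitone_nat_of_succ_le
    intro n
    rintro _ ⟨y, hy, rfl⟩
    rw [hws]
    split_ifs
    · exact ⟨y, hA1 n hy, rfl⟩
    · exact ⟨h n y, hA2 n hy, rfl⟩
  let p : (ℕ → ZMod 2) → ℕ → X := fun α n => w α n (x n)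
  have hpC : ∀ α n m, n ≤ m → p α m ∈ C α n := fun α n m hnm =>
    hCa α hnm ⟨x m, hx m, rfl⟩
  have hlim : ∀ α, ∃ y, Tendsto (p α) atTop (𝓝 y) := by
    intro α
    apply cauchySeq_tendsto_of_complete
    rw [← cauchySeq_shift 1]
    apply cauchySeq_of_le_geometric (1 / 2) 1 (by norm_num)
    intro n
    rw [one_mul]
    obtain ⟨a, ha, ha'⟩ := hpC α (n + 1) (n + 1) le_rfl
    obtain ⟨b, hb, hb'⟩ := hpC α (n + 1) (n + 1 + 1) (Nat.le_succ _)
    rw [← ha', ← hb']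
    exact hd n _ (hwW α (n + 1)) _ ha _ hb
  choose φ hφ using hlim
  have hφC : ∀ α n, φ α ∈ closure (C α n) := by
    intro α n
    refine mem_closure_of_tendsto (hφ α) ?_
    filter_upwards [eventually_ge_atTop n] with m hm
    exact hpC α n m hm
  have hkey : ∀ α β n, α n = 0 → β n ≠ 0 → ∀ j ≤ n + i0, g j (φ α) ≠ φ β := by
    intro α β n ha hb j hj
    have h1 := hφC α (n + 1)
    have h2 := hφC β (n + 1)
    simp only [C, hws, ha, hb, if_true, if_false] at h1 h2
    exact hsep n _ (hwW α n) _ (hwW β n) j hj _ h1 _ h2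
  have hzero : ∀ α n, E (φ (fun m => if m < n then 0 else α m)) (φ α) := by
    intro α n
    set γ : ℕ → ZMod 2 := fun m => if m < n then 0 else α m with hγ
    have hγ0 : ∀ m ≤ n, w γ m = id := by
      intro m hm
      induction m with
      | zero => rfl
      | succ m ih =>
        rw [hws, if_pos (by simp only [hγ]; rw [if_pos (by omega)]), ih (by omega)]
    have hcomp : ∀ k, w α (n + k) = w α n ∘ w γ (n + k) := by
      intro k
      induction k with
      | zero => rw [add_zero, hγ0 n le_rfl]; rfl
      | succ k ih =>
        have e : γ (n + k) = α (n + k) := by simp [hγ]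
        rw [← add_assoc, hws, hws, e, ih]
        split_ifs
        · rfl
        · rfl
    obtain ⟨i, hi⟩ := hWg n _ (hwW α n)
    have hlim : Tendsto (fun m => (p γ m, p α m)) atTop (𝓝 (φ γ, φ α)) :=
      (hφ γ).prodMk_nhds (hφ α)
    have hmem := (hcl i).mem_of_tendsto hlim (by
      filter_upwards [eventually_ge_atTop n] with m hm
      obtain ⟨k, rfl⟩ := Nat.exists_eq_add_of_le hm
      change g i (w γ (n + k) (x (n + k))) = w α (n + k) (x (n + k))
      rw [hcomp k, ← hi]
      rfl)
    have hmem' : g i (φ γ) = φ α := hmem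
    rw [← hmem']
    exact hgE i _
  have hne2 : ∀ a b : ZMod 2, a ≠ b → (a = 0 ∧ b ≠ 0) ∨ (b = 0 ∧ a ≠ 0) := by decide
  refine ⟨φ, ?_, ?_, ?_⟩
  · have hpm : ∀ n (y : X), Measurable fun α => w α n y := by
      intro n
      induction n with
      | zero => intro y; exact measurable_const
      | succ n ih =>
        intro y
        have e : (fun α => w α (n + 1) y) =
            fun α : ℕ → ZMod 2 => if α n = 0 then w α n y else w α n (h n y) := by
          funext α
          rw [hws]
          split_ifs <;> rfl
        rw [e]
        have hs : MeasurableSet {α : ℕ → ZMod 2 | α n = 0} :=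
          measurableSet_eq_fun (measurable_pi_apply n) measurable_const
        exact Measurable.ite hs (ih y) (ih _)
    exact measurable_of_tendsto_metrizable (fun n => hpm n (x n)) (tendsto_pi_nhds.2 hφ)
  · intro α β hab
    by_contra hne
    obtain ⟨n, hn⟩ := Function.ne_iff.1 hne
    rcases hne2 _ _ hn with ⟨h1, h2⟩ | ⟨h1, h2⟩
    · exact hkey α β n h1 h2 i0 (Nat.le_add_left _ _) (by rw [hi0]; exact hab)
    · exact hkey β α n h1 h2 i0 (Nat.le_add_left _ _) (by rw [hi0]; exact hab.symm)
  · intro α β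
    constructor
    · intro hab
      by_contra hinf
      have hinf : {n | α n ≠ β n}.Infinite := hinf
      obtain ⟨i, hi⟩ := hgs _ _ hab
      obtain ⟨j, hj⟩ := hgs _ _ (hE.symm hab)
      obtain ⟨n, hn, hgt⟩ := hinf.exists_gt (max i j)
      have hni : i ≤ n + i0 := ((le_max_left i j).trans hgt.le).trans (Nat.le_add_right _ _)
      have hnj : j ≤ n + i0 := ((le_max_right i j).trans hgt.le).trans (Nat.le_add_right _ _)
      rcases hne2 _ _ hn with ⟨h1, h2⟩ | ⟨h1, h2⟩
      · exact hkey α β n h1 h2 i hni hi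
      · exact hkey β α n h1 h2 j hnj hj
    · intro hfin
      obtain ⟨N, hN⟩ := hfin.bddAbove
      have e : (fun m => if m < N + 1 then 0 else α m) =
          (fun m => if m < N + 1 then 0 else β m) := by
        funext m
        split_ifs with hm
        · rfl
        · by_contra hne
          exact hm (Nat.lt_succ_of_le (hN hne))
      have h1 := hzero α (N + 1)
      have h2 := hzero β (N + 1)
      rw [e] at h1
      exact hE.trans (hE.symm h1) h2

lemma BR.embedding {X : Type*} [mX : MeasurableSpace X] [StandardBorelSpace X]
    (E : X → X → Prop) (hE : Equivalence E)
    (g : ℕ → X → X) (hgm : ∀ i, Measurable (g i)) (hgE : ∀ i x, E x (g i x))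
    (hgs : ∀ x y, E x y → ∃ i, g i x = y) (hgid : ∃ i, g i = id)
    (hgc : ∀ i j, ∃ k, g k = g i ∘ g j)
    (hns : ¬ BR.Small E (Set.univ : Set X)) :
    ∃ φ : (ℕ → ZMod 2) → X, Measurable φ ∧ Function.Injective φ ∧
      ∀ a b, E (φ a) (φ b) ↔ {n | a n ≠ b n}.Finite := by
  have h1 : ∃ t : TopologicalSpace X, @PolishSpace X t ∧ @BorelSpace X t _ := by
    let := upgradeStandardBorel X
    exact ⟨inferInstance, inferInstance, inferInstance⟩
  obtain ⟨t0, h0, hb⟩ := h1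
  obtain ⟨t, hle, ht1, ht2, ht3⟩ := BR.exists_top (fun x i => g i x : X → (ℕ → X))
    (measurable_pi_lambda _ hgm) t0 h0 hb
  have hcl : ∀ i, @IsClosed (X × X) (@instTopologicalSpaceProd X X t t)
      {p : X × X | g i p.1 = p.2} := by
    intro i
    have hc1 : Continuous[t, t0] (g i) :=
      (@continuous_pi_iff X ℕ (fun _ => X) t (fun _ => t0) _).1 ht3 i
    have hc2 : Continuous[t, t0] (id : X → X) := continuous_id_of_le hle
    have hc3 : Continuous[@instTopologicalSpaceProd X X t t, t0] (fun p : X × X => g i p.1) :=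
      @Continuous.comp (X × X) X X (@instTopologicalSpaceProd X X t t) t t0 _ _ hc1
        (@continuous_fst X X t t)
    have hc4 : Continuous[@instTopologicalSpaceProd X X t t, t0] (fun p : X × X => p.2) :=
      @Continuous.comp (X × X) X X (@instTopologicalSpaceProd X X t t) t t0 _ _ hc2
        (@continuous_snd X X t t)
    exact @isClosed_eq X (X × X) t0 (@instTopologicalSpaceProd X X t t) inferInstance _ _ hc3 hc4
  exact @BR.embedding_top X _ _ t ht1 ht2 E hE g hgm hgE hgs hgid hgc hcl hns

lemma BR.haar (μ : Measure (ℕ → ZMod 2)) [μ.IsAddHaarMeasure] (S : Set (ℕ → ZMod 2))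
    (hS : MeasurableSet S)
    (hodd : ∀ m, ∀ a ∈ S, ∀ b ∈ S, a - b ≠ Pi.single m 1) : μ S = 0 := by
  by_contra hne
  have h := Measure.sub_mem_nhds_zero_of_addHaar_pos μ S hS (pos_iff_ne_zero.2 hne)
  have ht : Tendsto (fun m : ℕ => (Pi.single m 1 : ℕ → ZMod 2)) atTop (𝓝 0) := by
    rw [tendsto_pi_nhds]
    intro i
    apply tendsto_const_nhds.congr'
    filter_upwards [eventually_gt_atTop i] with m hm
    rw [Pi.single_eq_of_ne (by omega)]
    rfl
  obtain ⟨m, hm⟩ := (ht.eventually h).exists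
  obtain ⟨a, ha, b, hb, hab⟩ := Set.mem_sub.1 hm
  exact hodd m a ha b hb hab

lemma BR.countable_fin_support :
    {t : ℕ → ZMod 2 | (Function.support t).Finite}.Countable := by
  refine (Set.countable_range (fun f : ℕ →₀ ZMod 2 => (f : ℕ → ZMod 2))).mono ?_
  intro t ht
  exact ⟨Finsupp.ofSupportFinite t ht, rfl⟩

/-- The set of finitely supported sequences of even weight. -/
def BR.Ev : Set (ℕ → ZMod 2) := {t | (Function.support t).Finite ∧ ∑ᶠ i, t i = 0}

lemma BR.not_ev_single (m : ℕ) : (Pi.single m 1 : ℕ → ZMod 2) ∉ BR.Ev := by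
  intro h
  have h2 := h.2
  rw [finsum_eq_single _ m (fun x hx => Pi.single_eq_of_ne hx _), Pi.single_eq_same] at h2
  exact absurd h2 (by decide)

lemma BR.fin_single (m : ℕ) : (Function.support (Pi.single m 1 : ℕ → ZMod 2)).Finite :=
  (Set.finite_singleton m).subset Pi.support_single_subset

lemma BR.fin_sub {a b : ℕ → ZMod 2} (ha : (Function.support a).Finite)
    (hb : (Function.support b).Finite) : (Function.support (a - b)).Finite :=
  (ha.union hb).subset (Function.support_sub a b)

lemma BR.fin_neg {a : ℕ → ZMod 2} (ha : (Function.support a).Finite) :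
    (Function.support (-a)).Finite := by
  have := BR.fin_sub (a := 0) (b := a) (by simp) ha
  simpa using this

/-- Combinatorial core for the relation `E₀` and a Borel complete section. -/
lemma BR.no_section (S : Set (ℕ → ZMod 2)) (hS : MeasurableSet S)
    (hdich : ∀ z : ℕ → ZMod 2, (∃ t, (Function.support t).Finite ∧ z + t ∈ S) ∧
      ({t | (Function.support t).Finite ∧ z + t ∈ S}.Finite ∨
        ∀ t u, (Function.support t).Finite → (Function.support u).Finite → z + t ∈ S →
          z + u ∈ S → t - u ∈ BR.Ev)) : False := by
  let μ : Measure (ℕ → ZMod 2) := Measure.addHaar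
  let D : Set (ℕ → ZMod 2) := {t | (Function.support t).Finite}
  have hD : D.Countable := BR.countable_fin_support
  have hDc : Countable D := hD.to_subtype
  let ρ := embeddingReal (ℕ → ZMod 2)
  have hρ : Measurable ρ := measurable_embeddingReal _
  have hρi : Function.Injective ρ := (measurableEmbedding_embeddingReal _).injective
  let S3 : Set (ℕ → ZMod 2) := {z | z ∈ S ∧ ∀ t : D, z + t.1 ∈ S → t.1 ∈ BR.Ev}
  let S2 : Set (ℕ → ZMod 2) := {z | z ∈ S ∧ ∀ t : D, z + t.1 ∈ S → ρ z ≤ ρ (z + t.1)}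
  have h3m : MeasurableSet S3 := by
    have e : S3 = S ∩ ⋂ t : D, ((fun z => z + t.1) ⁻¹' Sᶜ ∪ {z | t.1 ∈ BR.Ev}) := by
      ext z
      simp only [S3, Set.mem_inter_iff, Set.mem_iInter, Set.mem_union, Set.mem_preimage,
        Set.mem_ofPred_eq, Set.mem_compl_iff, imp_iff_not_or]
    rw [e]
    exact hS.inter (MeasurableSet.iInter fun t =>
      ((measurable_add_const t.1) hS.compl).union (MeasurableSet.const _))
  have h2m : MeasurableSet S2 := by
    have e : S2 = S ∩ ⋂ t : D, ((fun z => z + t.1) ⁻¹' Sᶜ ∪ {z | ρ z ≤ ρ (z + t.1)}) := by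
      ext z
      simp only [S2, Set.mem_inter_iff, Set.mem_iInter, Set.mem_union, Set.mem_preimage,
        Set.mem_ofPred_eq, Set.mem_compl_iff, imp_iff_not_or]
    rw [e]
    exact hS.inter (MeasurableSet.iInter fun t =>
      ((measurable_add_const t.1) hS.compl).union
        (measurableSet_le hρ (hρ.comp (measurable_add_const t.1))))
  have h3 : μ S3 = 0 := by
    apply BR.haar μ S3 h3m
    intro m a ha b hb hab
    have e : a = b + Pi.single m 1 := by rw [← hab]; abel
    exact BR.not_ev_single m (hb.2 ⟨_, BR.fin_single m⟩ (by rw [← e]; exact ha.1))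
  have h2 : μ S2 = 0 := by
    apply BR.haar μ S2 h2m
    intro m a ha b hb hab
    have e : b + Pi.single m 1 = a := by rw [← hab]; abel
    have e' : a + -Pi.single m 1 = b := by rw [← hab]; abel
    have i1 := hb.2 ⟨_, BR.fin_single m⟩ (by rw [e]; exact ha.1)
    have i2 := ha.2 ⟨_, BR.fin_neg (BR.fin_single m)⟩ (by rw [e']; exact hb.1)
    dsimp only at i1 i2
    rw [e] at i1
    rw [e'] at i2
    have := hρi (le_antisymm i1 i2)
    rw [this, sub_self] at hab
    have := congrFun hab m
    rw [Pi.single_eq_same, Pi.zero_apply] at this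
    exact zero_ne_one this
  have hcov : (Set.univ : Set (ℕ → ZMod 2)) ⊆ ⋃ t : D, (fun z => z + t.1) ⁻¹' (S2 ∪ S3) := by
    intro z _
    rw [Set.mem_iUnion]
    obtain ⟨⟨t, ht, hts⟩, hfin | hev⟩ := hdich z
    · obtain ⟨t, ⟨ht, hts⟩, hmin⟩ := Set.exists_min_image _ (fun t => ρ (z + t)) hfin ⟨t, ht, hts⟩
      refine ⟨⟨t, ht⟩, Or.inl ⟨hts, ?_⟩⟩
      rintro ⟨u, hu⟩ hus
      have hmem : (Function.support (t + u)).Finite :=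
        (ht.union hu).subset (Function.support_add t u)
      have := hmin (t + u) ⟨hmem, by rw [← add_assoc]; exact hus⟩
      dsimp only at this ⊢
      rw [add_assoc]
      exact this
    · refine ⟨⟨t, ht⟩, Or.inr ⟨hts, ?_⟩⟩
      rintro ⟨u, hu⟩ hus
      have hmem : (Function.support (t + u)).Finite :=
        (ht.union hu).subset (Function.support_add t u)
      have := hev (t + u) t hmem ht (by rw [← add_assoc]; exact hus) hts
      simpa using this
  have h0 : μ (Set.univ : Set (ℕ → ZMod 2)) = 0 := by
    refine measure_mono_null hcov (measure_iUnion_null fun t => ?_)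
    rw [measure_preimage_add_right]
    exact measure_union_null h2 h3
  exact (isOpen_univ.measure_ne_zero μ Set.univ_nonempty) h0

lemma BR.core {X : Type*} [MeasurableSpace X] [StandardBorelSpace X]
    (E : X → X → Prop) (hE : Equivalence E)
    (g : ℕ → X → X) (hgm : ∀ i, Measurable (g i)) (hgE : ∀ i x, E x (g i x))
    (hgs : ∀ x y, E x y → ∃ i, g i x = y)
    (φ : (ℕ → ZMod 2) → X) (hφm : Measurable φ) (hφi : Function.Injective φ)
    (hφE : ∀ a b, E (φ a) (φ b) ↔ {n | a n ≠ b n}.Finite)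
    (n k : ℕ) (hn : 1 < n) (hk : 1 < k) (hR : WeakBorelRamsey E n k) : False := by
  have hemb : MeasurableEmbedding φ := hφm.measurableEmbedding hφi
  have hK : MeasurableSet (Set.range φ) := hemb.measurableSet_range
  obtain ⟨ψ, hψm, hψ⟩ := hemb.exists_measurable_extend measurable_id (fun _ => ⟨0⟩)
  have hψ' : ∀ z, ψ (φ z) = z := fun z => congrFun hψ z
  have hφE' : ∀ a b, E (φ a) (φ b) ↔ (Function.support (a - b)).Finite := by
    intro a b
    rw [hφE]
    have : {n | a n ≠ b n} = Function.support (a - b) := by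
      ext i
      simp [sub_eq_zero]
    rw [this]
  let Q : X → ℕ → Prop := fun x i => g i x ∈ Set.range φ ∨ ∀ m, g m x ∉ Set.range φ
  have hQ : ∀ x, ∃ i, Q x i := by
    intro x
    by_cases h : ∃ i, g i x ∈ Set.range φ
    · obtain ⟨i, hi⟩ := h
      exact ⟨i, Or.inl hi⟩
    · exact ⟨0, Or.inr (not_exists.1 h)⟩
  have hI : Measurable fun x => Nat.find (hQ x) := by
    apply measurable_find
    intro i
    have : {x | Q x i} = (g i) ⁻¹' Set.range φ ∪ ⋂ m, (g m) ⁻¹' (Set.range φ)ᶜ := by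
      ext x
      simp only [Q, Set.mem_union, Set.mem_iInter, Set.mem_preimage, Set.mem_compl_iff,
        Set.mem_ofPred_eq]
    rw [this]
    exact (hgm i hK).union (MeasurableSet.iInter fun m => hgm m hK.compl)
  let r : X → (ℕ → ZMod 2) := fun x => ψ (g (Nat.find (hQ x)) x)
  have hr : Measurable r := by
    have h : Measurable fun q : ℕ × X => g q.1 q.2 := measurable_from_prod_countable_right hgm
    exact hψm.comp (h.comp (hI.prodMk measurable_id))
  have hrE : ∀ x z, E x (φ z) → E x (φ (r x)) := by
    intro x z hxz
    obtain ⟨i, hi⟩ := hgs x _ hxz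
    rcases Nat.find_spec (hQ x) with ⟨u, hu⟩ | h
    · have e : r x = u := by
        simp only [r]
        rw [← hu, hψ']
      rw [e, hu]
      exact hgE _ x
    · exact absurd ⟨z, hi.symm⟩ (h i)
  have hEvm : MeasurableSet BR.Ev :=
    (BR.countable_fin_support.mono (fun t ht => ht.1)).measurableSet
  let c0 : Fin k := ⟨0, by omega⟩
  let c1 : Fin k := ⟨1, hk⟩
  have hc01 : c0 ≠ c1 := by simp [c0, c1]
  let c : Finset X → Fin k := fun A => if ∀ a ∈ A, ∀ b ∈ A, r a - r b ∈ BR.Ev then c0 else c1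
  have hc : IsBorelColoring n c := by
    unfold IsBorelColoring
    have hs : MeasurableSet {v : Fin n → X | ∀ a ∈ (Set.finite_range v).toFinset,
        ∀ b ∈ (Set.finite_range v).toFinset, r a - r b ∈ BR.Ev} := by
      have e : {v : Fin n → X | ∀ a ∈ (Set.finite_range v).toFinset,
          ∀ b ∈ (Set.finite_range v).toFinset, r a - r b ∈ BR.Ev} =
          ⋂ i, ⋂ j, (fun v : Fin n → X => r (v i) - r (v j)) ⁻¹' BR.Ev := by
        ext v
        simp
      rw [e]
      exact MeasurableSet.iInter fun i => MeasurableSet.iInter fun j =>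
        ((hr.comp (measurable_pi_apply i)).sub (hr.comp (measurable_pi_apply j))) hEvm
    exact Measurable.ite hs measurable_const measurable_const
  obtain ⟨Y, hYm, hYc, hYmono⟩ := hR c hc
  let S : Set (ℕ → ZMod 2) := {z | ∃ i, g i (φ z) ∈ Y ∧ r (g i (φ z)) = z}
  have hS : MeasurableSet S := by
    have e : S = ⋃ i, ((fun z => g i (φ z)) ⁻¹' Y ∩ {z | r (g i (φ z)) = z}) := by
      ext z
      simp [S]
    rw [e]
    exact MeasurableSet.iUnion fun i => (((hgm i).comp hφm) hYm).inter
      (measurableSet_eq_fun (hr.comp ((hgm i).comp hφm)) measurable_id)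
  apply BR.no_section S hS
  intro z
  have hmemS : ∀ y ∈ Y, E (φ z) y → r y ∈ S ∧ (Function.support (r y - z)).Finite := by
    intro y hy hzy
    have h1 := hrE y z (hE.symm hzy)
    obtain ⟨i, hi⟩ := hgs _ _ (hE.symm h1)
    refine ⟨⟨i, by rw [hi]; exact hy, by rw [hi]⟩, ?_⟩
    rw [← hφE']
    exact hE.symm (hE.trans hzy h1)
  have hSmem : ∀ t, (Function.support t).Finite → z + t ∈ S →
      ∃ y ∈ Y, E (φ z) y ∧ r y = z + t := by
    rintro t ht ⟨i, hi1, hi2⟩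
    refine ⟨_, hi1, ?_, hi2⟩
    refine hE.trans ?_ (hgE i _)
    rw [hφE', sub_add_cancel_left]
    exact BR.fin_neg ht
  constructor
  · obtain ⟨y, hy, hzy⟩ := hYc (φ z)
    obtain ⟨h1, h2⟩ := hmemS y hy hzy
    exact ⟨r y - z, h2, by rw [add_sub_cancel]; exact h1⟩
  by_cases hfin : {y | y ∈ Y ∧ E (φ z) y}.Finite
  · left
    refine (hfin.image (fun y => r y - z)).subset ?_
    rintro t ⟨ht, hts⟩
    obtain ⟨y, hy, hzy, e⟩ := hSmem t ht hts
    exact ⟨y, ⟨hy, hzy⟩, by dsimp only; rw [e, add_sub_cancel_left]⟩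
  right
  have hinf : {y | y ∈ Y ∧ E (φ z) y}.Infinite := hfin
  obtain ⟨a, ha⟩ := hYmono (φ z)
  -- colour `c0` occurs
  have hc0 : a = c0 := by
    have hp : ∃ e : ZMod 2, {y | (y ∈ Y ∧ E (φ z) y) ∧ ∑ᶠ i, (r y - z) i = e}.Infinite := by
      by_contra hno
      simp only [not_exists, Set.not_infinite] at hno
      refine hinf ((Set.finite_iUnion hno).subset ?_)
      intro y hy
      exact Set.mem_iUnion.2 ⟨_, hy, rfl⟩
    obtain ⟨e, he⟩ := hp
    obtain ⟨A, hA1, hA2⟩ := he.exists_subset_card_eq n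
    rw [← ha A hA2 (fun y hy => (hA1 hy).1.1) (fun y hy => (hA1 hy).1.2)]
    refine if_pos ?_
    intro x hx y hy
    obtain ⟨⟨hx1, hx2⟩, hx3⟩ := hA1 hx
    obtain ⟨⟨hy1, hy2⟩, hy3⟩ := hA1 hy
    have fx := (hmemS x hx1 hx2).2
    have fy := (hmemS y hy1 hy2).2
    have e1 : r x - r y = (r x - z) - (r y - z) := by abel
    rw [e1]
    refine ⟨BR.fin_sub fx fy, ?_⟩
    have := finsum_sub_distrib (f := r x - z) (g := r y - z) fx fy
    rw [hx3, hy3, sub_self] at this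
    exact this
  intro t u ht hu hts hus
  by_contra hnev
  obtain ⟨x, hx, hzx, ex⟩ := hSmem t ht hts
  obtain ⟨y, hy, hzy, ey⟩ := hSmem u hu hus
  have hnev' : r x - r y ∉ BR.Ev := by
    rw [ex, ey, add_sub_add_left_eq_sub]
    exact hnev
  have hxy : x ≠ y := by
    rintro rfl
    apply hnev'
    rw [sub_self]
    exact ⟨by simp, by simp⟩
  obtain ⟨B, hB1, hB2⟩ := (hinf.sdiff (Set.toFinite {x, y})).exists_subset_card_eq (n - 2)
  have hxB : x ∉ B := fun h => (hB1 h).2 (by simp)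
  have hyB : y ∉ B := fun h => (hB1 h).2 (by simp)
  have hcard : (insert x (insert y B)).card = n := by
    rw [Finset.card_insert_of_notMem (by simp [hxy, hxB]), Finset.card_insert_of_notMem hyB, hB2]
    omega
  have hsub : ∀ w ∈ insert x (insert y B), w ∈ Y ∧ E (φ z) w := by
    intro w hw
    rw [Finset.mem_insert, Finset.mem_insert] at hw
    rcases hw with rfl | rfl | hw
    · exact ⟨hx, hzx⟩
    · exact ⟨hy, hzy⟩
    · exact (hB1 hw).1
  have h1 := ha _ hcard (fun w hw => (hsub w hw).1) (fun w hw => (hsub w hw).2)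
  have h2 : c (insert x (insert y B)) = c1 := by
    refine if_neg fun h => hnev' (h x (by simp) y (by simp))
  exact hc01 (by rw [← hc0, ← h1, h2])

/-- If the weak Borel Ramsey property `E →*_B (E)^n_k` holds for some integers
`n, k > 1`, then `E` is smooth. -/
theorem smooth_of_weak_borel_ramsey {X : Type*} [MeasurableSpace X] [StandardBorelSpace X]
    (E : X → X → Prop) (hE : Equivalence E)
    (hEBorel : MeasurableSet {p : X × X | E p.1 p.2})
    (hcount : ∀ x : X, {y | E x y}.Countable)
    (haper : ∀ x : X, {y | E x y}.Infinite)
    (hex : ∃ n k : ℕ, 1 < n ∧ 1 < k ∧ WeakBorelRamsey E n k) :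
    IsSmooth E := by
  obtain ⟨g, hgm, hgE, hgs, hgid, hgc⟩ := BR.exists_functions E hE hEBorel hcount
  obtain ⟨n, k, hn, hk, hR⟩ := hex
  by_contra hsm
  have hns : ¬ BR.Small E (Set.univ : Set X) := fun h =>
    hsm (BR.smooth_of_small E hE g hgm hgE hgs h)
  obtain ⟨φ, h1, h2, h3⟩ := BR.embedding E hE g hgm hgE hgs hgid hgc hns
  exact BR.core E hE g hgm hgE hgs φ h1 h2 h3 n k hn hk hR
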